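/- For every n ≥ 6 and every (ξ, η, ζ) ∈ D, there exists a doubly stochastic n×n matrix M = (m_{ij}) such that the football-model tournament probabilities p_{ij} = ∑_{a>b} m_{ia} m_{jb} + (1/2) ∑_a m_{ia} m_{ja} satisfy (p_{12}, p_{23}, p_{31}) = (ξ, η, ζ). -/

import Mathlib

open Finset

/-- The function `α` of Steinhaus and Trybuła. -/
noncomputable def alphaST (ξ η : ℝ) : ℝ :=
  if 1 < ξ + η then max (max ((1 - ξ) / η) ((1 - η) / ξ)) (1 - ξ * η) else 1

/-- The region `D` of Steinhaus and Trybuła. -/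
def DST : Set (ℝ × ℝ × ℝ) :=
  {t | t.1 ∈ Set.Icc (0 : ℝ) 1 ∧ t.2.1 ∈ Set.Icc (0 : ℝ) 1 ∧ t.2.2 ∈ Set.Icc (0 : ℝ) 1 ∧
    1 - alphaST (1 - t.1) (1 - t.2.1) ≤ t.2.2 ∧ t.2.2 ≤ alphaST t.1 t.2.1}

/-- The football-model tournament probability associated with a doubly
stochastic matrix `M`:
`p_{ij} = ∑_{a>b} m_{ia} m_{jb} + (1/2) ∑_a m_{ia} m_{ja}`. -/
noncomputable def footballP (n : ℕ) (M : Fin n → Fin n → ℝ) (i j : Fin n) : ℝ :=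
  (∑ a : Fin n, ∑ b : Fin n, if (b : ℕ) < (a : ℕ) then M i a * M j b else 0) +
    (1 / 2) * ∑ a : Fin n, M i a * M j a

/-- The triple `(x, y, z)` is the triple of cyclic winning probabilities of three probability
vectors on six points which can be jointly extended to a doubly stochastic matrix. -/
def CyclicRealizable (x y z : ℝ) : Prop :=
  ∃ f g h : Fin 6 → ℝ, (∀ j, 0 ≤ f j) ∧ (∀ j, 0 ≤ g j) ∧ (∀ j, 0 ≤ h j) ∧
    ∑ j, f j = 1 ∧ ∑ j, g j = 1 ∧ ∑ j, h j = 1 ∧ (∀ j, f j + g j + h j ≤ 1) ∧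
    (∑ a : Fin 6, ∑ b : Fin 6, if (b : ℕ) < a then f a * g b else 0) +
      (1 / 2) * ∑ a, f a * g a = x ∧
    (∑ a : Fin 6, ∑ b : Fin 6, if (b : ℕ) < a then g a * h b else 0) +
      (1 / 2) * ∑ a, g a * h a = y ∧
    (∑ a : Fin 6, ∑ b : Fin 6, if (b : ℕ) < a then h a * f b else 0) +
      (1 / 2) * ∑ a, h a * f a = z

theorem CyclicRealizable.rotate {x y z : ℝ} (H : CyclicRealizable x y z) :
    CyclicRealizable y z x := by
  obtain ⟨f, g, h, hf, hg, hh, sf, sg, sh, hle, hx, hy, hz⟩ := H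
  exact ⟨g, h, f, hg, hh, hf, sg, sh, sf, fun j => by linarith [hle j], hy, hz, hx⟩

theorem sum_lt_rev_eq_one_sub (f g : Fin 6 → ℝ) (sf : ∑ j, f j = 1) (sg : ∑ j, g j = 1) :
    (∑ a : Fin 6, ∑ b : Fin 6, if (b : ℕ) < a then f a.rev * g b.rev else 0) +
      (1 / 2) * ∑ a : Fin 6, f a.rev * g a.rev =
    1 - ((∑ a : Fin 6, ∑ b : Fin 6, if (b : ℕ) < a then f a * g b else 0) +
      (1 / 2) * ∑ a, f a * g a) := by
  have key : (∑ j, f j) * ∑ j, g j = 1 := by rw [sf, sg, one_mul]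
  simp [Fin.sum_univ_six, Fin.rev] at key ⊢
  linear_combination key

theorem CyclicRealizable.compl {x y z : ℝ} (H : CyclicRealizable x y z) :
    CyclicRealizable (1 - x) (1 - y) (1 - z) := by
  obtain ⟨f, g, h, hf, hg, hh, sf, sg, sh, hle, hx, hy, hz⟩ := H
  refine ⟨fun j => f j.rev, fun j => g j.rev, fun j => h j.rev, fun j => hf _, fun j => hg _,
    fun j => hh _, ?_, ?_, ?_, fun j => hle _, ?_, ?_, ?_⟩
  · rw [← sf]; exact Equiv.sum_comp Fin.revPerm f
  · rw [← sg]; exact Equiv.sum_comp Fin.revPerm g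
  · rw [← sh]; exact Equiv.sum_comp Fin.revPerm h
  · rw [sum_lt_rev_eq_one_sub f g sf sg, hx]
  · rw [sum_lt_rev_eq_one_sub g h sg sh, hy]
  · rw [sum_lt_rev_eq_one_sub h f sh sf, hz]

theorem cyclicRealizable_of_one_sub_le {x y z : ℝ} (hx0 : 0 ≤ x) (hx1 : x ≤ 1) (hy0 : 0 ≤ y)
    (hy1 : y ≤ 1) (h1 : 1 - y ≤ z) (hz : z + x * y ≤ 1) : CyclicRealizable x y z := by
  have hx' : 0 ≤ 1 - x := by linarith
  have hy' : 0 ≤ 1 - y := by linarith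
  obtain ⟨s, ⟨hs0, hs1⟩, hs⟩ : ∃ s ∈ Set.Icc (0 : ℝ) 1, (1 - y) + (1 - x) * y * s = z := by
    apply intermediate_value_Icc (f := fun s : ℝ => (1 - y) + (1 - x) * y * s) zero_le_one
      (by fun_prop)
    constructor <;> linarith
  have hs' : 0 ≤ 1 - s := by linarith
  have p1 : 0 ≤ y * (1 - s) := by positivity
  have p2 : 0 ≤ y * s := by positivity
  refine ⟨![0, 1 - x, 0, 0, x, 0], ![0, 0, 0, 1, 0, 0],
    ![y * (1 - s), 0, y * s, 0, 0, 1 - y], ?_, ?_, ?_, ?_, ?_, ?_, ?_, ?_, ?_, ?_⟩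
  any_goals
    simp [Fin.forall_fin_succ, Fin.sum_univ_six] <;> (try constructorm* _ ∧ _) <;> nlinarith

theorem cyclicRealizable_of_le_one_sub {x y z : ℝ} (hx0 : 0 ≤ x) (hx1 : x ≤ 1) (hy0 : 0 ≤ y)
    (hy1 : y ≤ 1) (h1 : z ≤ 1 - y) (h2 : (1 - x) * (1 - y) ≤ z) : CyclicRealizable x y z := by
  have hx' : 0 ≤ 1 - x := by linarith
  have hy' : 0 ≤ 1 - y := by linarith
  obtain ⟨s, ⟨hs0, hs1⟩, hs⟩ :
      ∃ s ∈ Set.Icc (0 : ℝ) 1, (1 - x) * (1 - y) + x * (1 - y) * s = z := by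
    apply intermediate_value_Icc (f := fun s : ℝ => (1 - x) * (1 - y) + x * (1 - y) * s)
      zero_le_one (by fun_prop)
    constructor <;> linarith
  have hs' : 0 ≤ 1 - s := by linarith
  have p1 : 0 ≤ (1 - y) * (1 - s) := by positivity
  have p2 : 0 ≤ (1 - y) * s := by positivity
  refine ⟨![0, 1 - x, 0, 0, x, 0], ![0, 0, 1, 0, 0, 0],
    ![y, 0, 0, (1 - y) * (1 - s), 0, (1 - y) * s], ?_, ?_, ?_, ?_, ?_, ?_, ?_, ?_, ?_, ?_⟩
  any_goals
    simp [Fin.forall_fin_succ, Fin.sum_univ_six] <;> (try constructorm* _ ∧ _) <;> nlinarith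

theorem cyclicRealizable_of_lt_mul {x y z : ℝ} (hx1 : x ≤ 1) (hy0 : 0 ≤ y) (hy1 : y ≤ 1)
    (hz0 : 0 ≤ z) (hxy : 1 ≤ x + y) (h2 : z < (1 - x) * (1 - y)) : CyclicRealizable x y z := by
  have hx' : 0 ≤ 1 - x := by linarith
  have hy' : 0 ≤ 1 - y := by linarith
  have hy : 0 < y := by
    by_contra hy
    have : (1 - x) * (1 - y) ≤ 0 := by nlinarith
    linarith
  obtain ⟨t, ⟨ht0, ht1⟩, ht⟩ : ∃ t ∈ Set.Icc y 1, (1 - x) * (t - y) - z * t ^ 2 = 0 := by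
    apply intermediate_value_Icc (f := fun t : ℝ => (1 - x) * (t - y) - z * t ^ 2) hy1
      (by fun_prop)
    constructor
    · have : 0 ≤ z * y ^ 2 := by positivity
      linarith
    · linarith
  have htpos : 0 < t := hy.trans_le ht0
  obtain ⟨a, ha⟩ : ∃ a, a * t = 1 - x := ⟨(1 - x) / t, by field_simp⟩
  obtain ⟨b, hb⟩ : ∃ b, b * t = t - y := ⟨(t - y) / t, by field_simp⟩
  have hab : a * b = z := by
    have : a * b * t ^ 2 = z * t ^ 2 := by
      linear_combination ht + b * t * ha + (1 - x) * hb
    exact mul_right_cancel₀ (by positivity) this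
  have ha0 : 0 ≤ a := nonneg_of_mul_nonneg_left (ha ▸ hx') htpos
  have hb0 : 0 ≤ b := nonneg_of_mul_nonneg_left (by linarith) htpos
  have ha1 : a ≤ 1 := le_of_mul_le_mul_right (by linarith) htpos
  have hb1 : b ≤ 1 := le_of_mul_le_mul_right (by linarith) htpos
  refine ⟨![0, 0, a, 0, 0, 1 - a], ![1 - t, 0, 0, t, 0, 0], ![0, 1 - b, 0, 0, b, 0],
    ?_, ?_, ?_, ?_, ?_, ?_, ?_, ?_, ?_, ?_⟩
  any_goals
    simp [Fin.forall_fin_succ, Fin.sum_univ_six] <;> (try constructorm* _ ∧ _) <;> nlinarith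

theorem cyclicRealizable_of_le {x y z : ℝ} (hx0 : 0 ≤ x) (hx1 : x ≤ 1) (hy0 : 0 ≤ y)
    (hy1 : y ≤ 1) (hz0 : 0 ≤ z) (hxy : 1 ≤ x + y) (hz : z + x * y ≤ 1) :
    CyclicRealizable x y z := by
  rcases le_total (1 - y) z with h1 | h1
  · exact cyclicRealizable_of_one_sub_le hx0 hx1 hy0 hy1 h1 hz
  rcases le_or_gt ((1 - x) * (1 - y)) z with h2 | h2
  · exact cyclicRealizable_of_le_one_sub hx0 hx1 hy0 hy1 h1 h2
  · exact cyclicRealizable_of_lt_mul hx1 hy0 hy1 hz0 hxy h2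

theorem cyclicRealizable_of_one_le_add {x y z : ℝ} (hx0 : 0 ≤ x) (hx1 : x ≤ 1) (hy0 : 0 ≤ y)
    (hy1 : y ≤ 1) (hz0 : 0 ≤ z) (hz1 : z ≤ 1) (hxy : 1 ≤ x + y)
    (hz : z + x * y ≤ 1 ∨ x + y * z ≤ 1 ∨ y + z * x ≤ 1) : CyclicRealizable x y z := by
  by_cases h : z + x * y ≤ 1
  · exact cyclicRealizable_of_le hx0 hx1 hy0 hy1 hz0 hxy h
  rcases hz with h1 | h1 | h1
  · exact absurd h1 h
  · have : 1 ≤ y + z := by nlinarith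
    exact (cyclicRealizable_of_le hy0 hy1 hz0 hz1 hx0 this h1).rotate.rotate
  · have : 1 ≤ z + x := by nlinarith
    exact (cyclicRealizable_of_le hz0 hz1 hx0 hx1 hy0 this h1).rotate

theorem or_of_le_alphaST {x y z : ℝ} (hx1 : x ≤ 1) (hy1 : y ≤ 1) (hxy : 1 < x + y)
    (hz : z ≤ alphaST x y) : z + x * y ≤ 1 ∨ x + y * z ≤ 1 ∨ y + z * x ≤ 1 := by
  rw [alphaST, if_pos hxy, le_max_iff, le_max_iff, le_div_iff₀ (by linarith),
    le_div_iff₀ (by linarith)] at hz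
  rcases hz with (h | h) | h
  · exact Or.inr (Or.inl (by linarith))
  · exact Or.inr (Or.inr (by linarith))
  · exact Or.inl (by linarith)

theorem cyclicRealizable_of_mem_DST {x y z : ℝ} (h : (x, y, z) ∈ DST) :
    CyclicRealizable x y z := by
  obtain ⟨⟨hx0, hx1⟩, ⟨hy0, hy1⟩, ⟨hz0, hz1⟩, hl, hu⟩ := h
  dsimp only at *
  rcases lt_trichotomy (x + y) 1 with hxy | hxy | hxy
  · have := (cyclicRealizable_of_one_le_add (x := 1 - x) (y := 1 - y) (z := 1 - z)
      (by linarith) (by linarith) (by linarith) (by linarith) (by linarith) (by linarith)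
      (by linarith) (or_of_le_alphaST (by linarith) (by linarith) (by linarith)
        (by linarith))).compl
    simpa using this
  · by_cases h : z + x * y ≤ 1
    · exact cyclicRealizable_of_le hx0 hx1 hy0 hy1 hz0 hxy.ge h
    · have := (cyclicRealizable_of_le (x := 1 - x) (y := 1 - y) (z := 1 - z)
        (by linarith) (by linarith) (by linarith) (by linarith) (by linarith) (by linarith)
        (by nlinarith)).compl
      simpa using this
  · exact cyclicRealizable_of_one_le_add hx0 hx1 hy0 hy1 hz0 hz1 hxy.le
      (or_of_le_alphaST hx1 hy1 hxy hu)

/-- Winning probabilities are unchanged when the two measures are extended by zero. -/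
theorem footballP_of_append {k : ℕ} (M : Fin (6 + k) → Fin (6 + k) → ℝ) (i j : Fin (6 + k))
    (f g : Fin 6 → ℝ) (hi : M i = Fin.append f 0) (hj : M j = Fin.append g 0) :
    footballP (6 + k) M i j =
      (∑ a : Fin 6, ∑ b : Fin 6, if (b : ℕ) < a then f a * g b else 0) +
        (1 / 2) * ∑ a, f a * g a := by
  simp [footballP, hi, hj, Fin.sum_univ_add, -Fin.val_fin_lt]

/-- **Nontransitivity in the football model.** For every `n ≥ 6`, every triple
in `D` is realized as `(p_{12}, p_{23}, p_{31})` by some element of the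
football model. -/
theorem football_realizes_all_cyclic_triples (n : ℕ) (hn : 6 ≤ n)
    (ξ η ζ : ℝ) (hD : (ξ, η, ζ) ∈ DST) :
    ∃ M : Fin n → Fin n → ℝ,
      (∀ i j, 0 ≤ M i j) ∧
      (∀ i, ∑ j, M i j = 1) ∧
      (∀ j, ∑ i, M i j = 1) ∧
      footballP n M ⟨0, by omega⟩ ⟨1, by omega⟩ = ξ ∧
      footballP n M ⟨1, by omega⟩ ⟨2, by omega⟩ = η ∧
      footballP n M ⟨2, by omega⟩ ⟨0, by omega⟩ = ζ := by
  obtain ⟨f, g, h, hf, hg, hh, sf, sg, sh, hle, hx, hy, hz⟩ := cyclicRealizable_of_mem_DST hD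
  obtain ⟨k, rfl⟩ := Nat.exists_eq_add_of_le hn
  have hk : (0 : ℝ) < k + 3 := by positivity
  let r : Fin (6 + k) → ℝ :=
    Fin.append (fun j => (1 - (f j + g j + h j)) / (k + 3)) (fun _ => 1 / (k + 3))
  let rows : Fin 6 → Fin (6 + k) → ℝ :=
    ![Fin.append f 0, Fin.append g 0, Fin.append h 0, r, r, r]
  have r_nonneg : ∀ j, 0 ≤ r j := by
    intro j
    refine Fin.addCases (fun j => ?_) (fun j => ?_) j
    · simp only [r, Fin.append_left]
      exact div_nonneg (by linarith [hle j]) hk.le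
    · simp only [r, Fin.append_right]
      positivity
  have sum_r : ∑ j, r j = 1 := by
    simp only [r, Fin.sum_univ_add, Fin.append_left, Fin.append_right, ← Finset.sum_div,
      Finset.sum_sub_distrib, Finset.sum_add_distrib, sf, sg, sh]
    simp
    field_simp
    ring
  have append_nonneg : ∀ u : Fin 6 → ℝ, (∀ j, 0 ≤ u j) →
      ∀ j, 0 ≤ (Fin.append u 0 : Fin (6 + k) → ℝ) j := by
    intro u hu j
    refine Fin.addCases (fun j => ?_) (fun j => ?_) j <;> simp [hu]
  have sum_append : ∀ u : Fin 6 → ℝ, ∑ j, (Fin.append u 0 : Fin (6 + k) → ℝ) j = ∑ j, u j := by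
    intro u
    simp [Fin.sum_univ_add]
  refine ⟨Fin.append rows (fun _ => r), fun i => ?_, fun i => ?_, fun j => ?_, ?_, ?_, ?_⟩
  · refine Fin.addCases (fun i => ?_) (fun i => ?_) i
    · fin_cases i <;> simp [rows, append_nonneg, r_nonneg, hf, hg, hh]
    · simpa using r_nonneg
  · refine Fin.addCases (fun i => ?_) (fun i => ?_) i
    · fin_cases i <;> simp [rows, sum_append, sum_r, sf, sg, sh]
    · simpa using sum_r
  · refine Fin.addCases (fun j => ?_) (fun j => ?_) j <;>
    · simp [Fin.sum_univ_add, Fin.sum_univ_six, rows, r]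
      field_simp
      ring
  · rw [footballP_of_append _ _ _ f g rfl rfl, hx]
  · rw [footballP_of_append _ _ _ g h rfl rfl, hy]
  · rw [footballP_of_append _ _ _ h f rfl rfl, hz]
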